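/- arXiv:1807.06611 — 5 statements merged into one kernel-verified Lean document; each statement's English description precedes it below -/
import Mathlib

section
/- Let A ∈ ℝ^{n×n} be symmetric, x₀ ∈ ℝⁿ, and k ≥ 1. Let S = I − Π_{k-1} where Π_{k-1} is the orthogonal projection onto span{A^j x₀ : 0 ≤ j ≤ k−1}, and set y = A^k x₀. If S y ≠ 0, then the model estimate Â_k = A Π_k satisfies ‖A − Â_k‖_F² = ‖A S‖_F² − ‖A S y‖² / ‖S y‖², where ‖·‖_F is the Frobenius norm and ‖·‖ the Euclidean norm. -/
open Matrix

/-- `P` is the orthogonal projection matrix (symmetric and idempotent) onto the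
subspace `W` of `ℝⁿ` (with the standard inner product). -/
def IsOrthProjOnto {n : ℕ} (P : Matrix (Fin n) (Fin n) ℝ) (W : Submodule ℝ (Fin n → ℝ)) : Prop :=
  P.IsSymm ∧ P * P = P ∧ LinearMap.range P.mulVecLin = W

/-- `krylovSpan A x₀ m = span {A^j x₀ : 0 ≤ j ≤ m − 1}` (the span of the first `m` snapshots). -/
def krylovSpan {n : ℕ} (A : Matrix (Fin n) (Fin n) ℝ) (x₀ : Fin n → ℝ) (m : ℕ) :
    Submodule ℝ (Fin n → ℝ) :=
  Submodule.span ℝ (Set.range fun j : Fin m => (A ^ (j : ℕ)).mulVec x₀)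

theorem IsOrthProjOnto.mulVec_eq_self {n : ℕ} {P : Matrix (Fin n) (Fin n) ℝ}
    {W : Submodule ℝ (Fin n → ℝ)} (h : IsOrthProjOnto P W) {w : Fin n → ℝ} (hw : w ∈ W) :
    P.mulVec w = w := by
  obtain ⟨_, hidem, hrange⟩ := h
  rw [← hrange] at hw
  obtain ⟨v, rfl⟩ := hw
  rw [mulVecLin_apply, mulVec_mulVec, hidem]

theorem IsOrthProjOnto.mulVec_mem {n : ℕ} {P : Matrix (Fin n) (Fin n) ℝ}
    {W : Submodule ℝ (Fin n → ℝ)} (h : IsOrthProjOnto P W) (v : Fin n → ℝ) :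
    P.mulVec v ∈ W := by
  rw [← h.2.2]
  exact ⟨v, rfl⟩

/-- A symmetric matrix that fixes `W` pointwise and has all its values in `W` is the orthogonal
projection onto `W`. -/
theorem IsOrthProjOnto.eq_of_isSymm {n : ℕ} {P Q : Matrix (Fin n) (Fin n) ℝ}
    {W : Submodule ℝ (Fin n → ℝ)} (h : IsOrthProjOnto P W) (hQ : Q.IsSymm)
    (hfix : ∀ w ∈ W, Q.mulVec w = w) (hmem : ∀ v, Q.mulVec v ∈ W) : P = Q := by
  have hQP : Q * P = P := by
    apply ext_of_mulVec_single
    intro i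
    rw [← mulVec_mulVec, hfix _ (h.mulVec_mem _)]
  have hPQ : P * Q = Q := by
    apply ext_of_mulVec_single
    intro i
    rw [← mulVec_mulVec, h.mulVec_eq_self (hmem _)]
  calc P = (Q * P)ᵀ := by rw [hQP, h.1.eq]
    _ = Q := by rw [transpose_mul, h.1.eq, hQ.eq, hPQ]

theorem krylovSpan_succ {n : ℕ} (A : Matrix (Fin n) (Fin n) ℝ) (x₀ : Fin n → ℝ) (k : ℕ) :
    krylovSpan A x₀ (k + 1) = krylovSpan A x₀ k ⊔ Submodule.span ℝ {(A ^ k).mulVec x₀} := by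
  rw [krylovSpan, krylovSpan, ← Submodule.span_union]
  congr 1
  ext v
  simp only [Set.mem_range, Set.mem_union, Set.mem_singleton_iff, Fin.exists_fin_succ',
    Fin.val_castSucc, Fin.val_last, eq_comm]

/-- Adjoining a vector `y` to `W` adds to the orthogonal projection the rank-one projection onto
the residual `y - P y`. -/
theorem IsOrthProjOnto.eq_add_vecMulVec {n : ℕ} {P Q : Matrix (Fin n) (Fin n) ℝ}
    {W : Submodule ℝ (Fin n → ℝ)} {y u : Fin n → ℝ} (hP : IsOrthProjOnto P W)
    (hQ : IsOrthProjOnto Q (W ⊔ Submodule.span ℝ {y})) (hu : u = y - P.mulVec y) (hu0 : u ≠ 0) :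
    Q = P + (u ⬝ᵥ u)⁻¹ • vecMulVec u u := by
  have hc : u ⬝ᵥ u ≠ 0 := fun h => hu0 (dotProduct_self_eq_zero.mp h)
  have horth : ∀ w ∈ W, u ⬝ᵥ w = 0 := by
    intro w hw
    have hPy : P.mulVec y ⬝ᵥ w = y ⬝ᵥ w := by
      rw [dotProduct_comm, dotProduct_mulVec, ← mulVec_transpose, hP.1.eq,
        hP.mulVec_eq_self hw, dotProduct_comm]
    rw [hu, sub_dotProduct, hPy, sub_self]
  have hy : y = P.mulVec y + u := by rw [hu]; abel
  have happ : ∀ v, (P + (u ⬝ᵥ u)⁻¹ • vecMulVec u u).mulVec v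
      = P.mulVec v + ((u ⬝ᵥ u)⁻¹ * (u ⬝ᵥ v)) • u := by
    intro v
    rw [add_mulVec, smul_mulVec, vecMulVec_mulVec, op_smul_eq_smul, smul_smul]
  refine hQ.eq_of_isSymm ?_ ?_ ?_
  · rw [IsSymm, transpose_add, transpose_smul, transpose_vecMulVec, hP.1.eq]
  · intro w hw
    obtain ⟨a, ha, b, hb, rfl⟩ := Submodule.mem_sup.mp hw
    obtain ⟨t, rfl⟩ := Submodule.mem_span_singleton.mp hb
    have huy : u ⬝ᵥ y = u ⬝ᵥ u := by
      conv_lhs => rw [hy]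
      rw [dotProduct_add, horth _ (hP.mulVec_mem y), zero_add]
    rw [mulVec_add, mulVec_smul, happ, happ, horth a ha, huy, hP.mulVec_eq_self ha,
      inv_mul_cancel₀ hc, one_smul, ← hy, mul_zero, zero_smul, add_zero]
  · intro v
    rw [happ]
    refine add_mem (Submodule.mem_sup_left (hP.mulVec_mem v)) (Submodule.smul_mem _ _ ?_)
    rw [hu]
    exact sub_mem (Submodule.mem_sup_right (Submodule.mem_span_singleton_self y))
      (Submodule.mem_sup_left (hP.mulVec_mem y))

/-- Removing from `B` its action along a nonzero vector `u` lowers the squared Frobenius norm by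
`‖B u‖² / ‖u‖²`. -/
theorem trace_transpose_mul_self_sub_vecMulVec {n : ℕ} (B : Matrix (Fin n) (Fin n) ℝ)
    {u : Fin n → ℝ} (hu : u ≠ 0) :
    trace ((B - (u ⬝ᵥ u)⁻¹ • vecMulVec (B.mulVec u) u)ᵀ *
        (B - (u ⬝ᵥ u)⁻¹ • vecMulVec (B.mulVec u) u))
      = trace (Bᵀ * B) - (B.mulVec u ⬝ᵥ B.mulVec u) / (u ⬝ᵥ u) := by
  have hc : u ⬝ᵥ u ≠ 0 := fun h => hu (dotProduct_self_eq_zero.mp h)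
  have hcross : trace (Bᵀ * vecMulVec (B.mulVec u) u) = B.mulVec u ⬝ᵥ B.mulVec u := by
    rw [mul_vecMulVec, trace_vecMulVec, mulVec_transpose, ← dotProduct_mulVec]
  have hcross' : trace (vecMulVec u (B.mulVec u) * B) = B.mulVec u ⬝ᵥ B.mulVec u := by
    rw [vecMulVec_mul, trace_vecMulVec, dotProduct_comm, ← dotProduct_mulVec]
  have hsq : trace (vecMulVec u (B.mulVec u) * vecMulVec (B.mulVec u) u)
      = (B.mulVec u ⬝ᵥ B.mulVec u) * (u ⬝ᵥ u) := by
    rw [vecMulVec_mul_vecMulVec, trace_vecMulVec]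
    simp
  simp only [transpose_sub, transpose_smul, transpose_vecMulVec, sub_mul, mul_sub, smul_mul,
    Matrix.mul_smul, trace_sub, trace_smul, hcross, hcross', hsq, smul_eq_mul]
  field_simp
  ring

/-- for symmetric `A`, with `S = I − Π_{k−1}`, `y = A^k x₀` and `S y ≠ 0`,
`‖A − Â_k‖_F² = ‖A S‖_F² − ‖A S y‖² / ‖S y‖²` (squared Frobenius norms written as
traces, squared Euclidean norms written as dot products). -/
theorem stmt_4 {n : ℕ} (A : Matrix (Fin n) (Fin n) ℝ) (hA : A.IsSymm)
    (x₀ : Fin n → ℝ) (k : ℕ) (hk : 1 ≤ k)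
    (Pprev Pk S : Matrix (Fin n) (Fin n) ℝ) (y : Fin n → ℝ)
    (hPprev : IsOrthProjOnto Pprev (krylovSpan A x₀ k))
    (hPk : IsOrthProjOnto Pk (krylovSpan A x₀ (k + 1)))
    (hS : S = 1 - Pprev) (hy : y = (A ^ k).mulVec x₀)
    (hSy : S.mulVec y ≠ 0) :
    Matrix.trace ((A - A * Pk)ᵀ * (A - A * Pk))
      = Matrix.trace ((A * S)ᵀ * (A * S))
        - (A.mulVec (S.mulVec y) ⬝ᵥ A.mulVec (S.mulVec y)) / (S.mulVec y ⬝ᵥ S.mulVec y) := by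
  have hu : S.mulVec y = y - Pprev.mulVec y := by rw [hS, sub_mulVec, one_mulVec]
  rw [krylovSpan_succ, ← hy] at hPk
  have hPk_eq := hPprev.eq_add_vecMulVec hPk hu hSy
  have hSS : S.mulVec (S.mulVec y) = S.mulVec y := by
    rw [mulVec_mulVec, hS, mul_sub, sub_mul, sub_mul, hPprev.2.1]
    simp
  have hASu : (A * S).mulVec (S.mulVec y) = A.mulVec (S.mulVec y) := by
    rw [← mulVec_mulVec, hSS]
  have hres : A - A * Pk = A * S - (S.mulVec y ⬝ᵥ S.mulVec y)⁻¹ •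
      vecMulVec ((A * S).mulVec (S.mulVec y)) (S.mulVec y) := by
    rw [hASu, ← mul_vecMulVec, ← Matrix.mul_smul, ← mul_sub, hPk_eq]
    nth_rw 1 [← mul_one A]
    rw [← mul_sub, ← sub_sub, ← hS]
  rw [hres, trace_transpose_mul_self_sub_vecMulVec _ hSy, hASu]
end

section
/- (Theorem 2) Let A ∈ ℝ^{n×n} be symmetric of rank r whose nonzero eigenvalues λ₁, …, λ_r are pairwise distinct, with orthonormal eigenvectors q₁, …, q_r, and let q̄_{r+1}, …, q̄_n be an orthonormal basis of ker A. Write x₀ = Σ_{i=1}^r ν_i q_i + Σ_{i=r+1}^n μ_i q̄_i with ν ≠ 0. Let 1 ≤ k < n, let S = I − Π_{k-1} with Π_{k-1} the orthogonal projection onto span{A^j x₀ : 0 ≤ j ≤ k−1}, and assume S A^k x₀ ≠ 0. Then the model estimate Â_k = A Π_k satisfies ‖A − Â_k‖_F² ≤ ( n − min{ k, |ν| + min{|μ|, 1} } ) λ₁² − λ_n², where |ν| and |μ| are the numbers of nonzero entries of ν and μ, and λ₁ and λ_n denote the largest and the smallest of the absolute values of the n eigenvalues of A (counted with multiplicity,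 including zeros). -/
open Matrix

/-- The Krylov spans are nested. -/
lemma krylovSpan_mono {n : ℕ} (A : Matrix (Fin n) (Fin n) ℝ) (x : Fin n → ℝ) (m : ℕ) :
    krylovSpan A x m ≤ krylovSpan A x (m + 1) := by
  refine Submodule.span_le.2 ?_
  rintro _ ⟨j, rfl⟩
  exact Submodule.subset_span ⟨j.castSucc, rfl⟩

/-- The last snapshot belongs to the Krylov span. -/
lemma pow_mulVec_mem_krylovSpan {n : ℕ} (A : Matrix (Fin n) (Fin n) ℝ) (x : Fin n → ℝ) (m : ℕ) :
    (A ^ m).mulVec x ∈ krylovSpan A x (m + 1) :=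
  Submodule.subset_span ⟨Fin.last m, rfl⟩

/-- Multiplication by `A` sends each Krylov span into the next one. -/
lemma mulVec_mem_krylovSpan_succ {n : ℕ} (A : Matrix (Fin n) (Fin n) ℝ) (x : Fin n → ℝ) (m : ℕ)
    {v : Fin n → ℝ} (hv : v ∈ krylovSpan A x m) : A.mulVec v ∈ krylovSpan A x (m + 1) := by
  have h : krylovSpan A x m ≤ (krylovSpan A x (m + 1)).comap A.mulVecLin := by
    refine Submodule.span_le.2 ?_
    rintro _ ⟨j, rfl⟩
    refine Submodule.subset_span ⟨j.succ, ?_⟩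
    simp [pow_succ', Matrix.mulVec_mulVec]
  exact h hv

/-- If the `m`-th snapshot is not spanned by the previous ones, the first `m + 1` snapshots
span a space of dimension at least `m + 1`. -/
lemma succ_le_finrank_krylovSpan {n : ℕ} (A : Matrix (Fin n) (Fin n) ℝ) (x : Fin n → ℝ) (m : ℕ)
    (hm : (A ^ m).mulVec x ∉ krylovSpan A x m) :
    m + 1 ≤ Module.finrank ℝ (krylovSpan A x (m + 1)) := by
  have hlt : ∀ l, (A ^ l).mulVec x ∉ krylovSpan A x l →
      Module.finrank ℝ (krylovSpan A x l) < Module.finrank ℝ (krylovSpan A x (l + 1)) :=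
    fun l hl => Submodule.finrank_lt_finrank_of_lt <|
      lt_of_le_of_ne (krylovSpan_mono A x l) fun h =>
        hl (h ▸ pow_mulVec_mem_krylovSpan A x l)
  induction m with
  | zero => have := hlt 0 hm; omega
  | succ m ih =>
    have hprev : (A ^ m).mulVec x ∉ krylovSpan A x m := fun h => hm <| by
      have := mulVec_mem_krylovSpan_succ A x m h
      rwa [Matrix.mulVec_mulVec, ← pow_succ'] at this
    have := hlt _ hm
    have := ih hprev
    omega

/-- The trace of an orthogonal projection is the dimension of its range. -/
lemma IsOrthProjOnto.trace_eq_finrank {n : ℕ} {P : Matrix (Fin n) (Fin n) ℝ}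
    {W : Submodule ℝ (Fin n → ℝ)} (hP : IsOrthProjOnto P W) :
    P.trace = Module.finrank ℝ W := by
  obtain ⟨-, hidem, rfl⟩ := hP
  have hproj : LinearMap.IsProj (LinearMap.range P.mulVecLin) P.mulVecLin := by
    refine ⟨fun v => ⟨v, rfl⟩, ?_⟩
    rintro _ ⟨v, rfl⟩
    simp [Matrix.mulVec_mulVec, hidem]
  rw [← hproj.trace, ← Matrix.toLin'_apply', Matrix.trace_toLin'_eq]

/-- The trace of a matrix is the sum of its diagonal entries in any orthonormal basis. -/
lemma trace_eq_sum_dotProduct {n : ℕ} {q : Fin n → Fin n → ℝ}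
    (horth : ∀ i j, q i ⬝ᵥ q j = if i = j then 1 else 0) (M : Matrix (Fin n) (Fin n) ℝ) :
    M.trace = ∑ i, q i ⬝ᵥ M.mulVec (q i) := by
  have hQ : Matrix.of q * (Matrix.of q)ᵀ = 1 := by
    ext i j
    simpa [Matrix.mul_apply, Matrix.one_apply, dotProduct] using horth i j
  have hQ' : (Matrix.of q)ᵀ * Matrix.of q = 1 := mul_eq_one_comm.1 hQ
  calc M.trace = (Matrix.of q * (M * (Matrix.of q)ᵀ)).trace := by
        rw [Matrix.trace_mul_comm, Matrix.mul_assoc, hQ', Matrix.mul_one]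
    _ = ∑ i, q i ⬝ᵥ M.mulVec (q i) := by
        simp [Matrix.trace, Matrix.mul_apply, dotProduct, Matrix.mulVec]

/-- Theorem 2: `A` is symmetric of rank `r`, `q 0, …, q (n-1)` is an
orthonormal eigenbasis with eigenvalues `lam i` (nonzero and pairwise distinct for `i < r`,
zero for `i ≥ r`, so `q i` for `i ≥ r` spans `ker A`), and `x₀ = ∑ i, c i • q i` with a
nonzero coefficient on some eigenvector of a nonzero eigenvalue (`ν ≠ 0`).  For `1 ≤ k < n`,
with `S = I − Π_{k−1}` and `S A^k x₀ ≠ 0`, the estimate `Â_k = A Π_k` satisfies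
`‖A − Â_k‖_F² ≤ (n − min{k, |ν| + min{|μ|,1}}) λ₁² − λ_n²`, where `λ₁` (resp. `λ_n`) is
the largest (resp. smallest) absolute value of the `n` eigenvalues of `A`. -/
theorem stmt_5 {n r k : ℕ} (hk1 : 1 ≤ k) (hkn : k < n)
    (A : Matrix (Fin n) (Fin n) ℝ) (hA : A.IsSymm)
    (q : Fin n → Fin n → ℝ) (lam : Fin n → ℝ)
    (horth : ∀ i j, q i ⬝ᵥ q j = if i = j then 1 else 0)
    (heig : ∀ i, A.mulVec (q i) = lam i • q i)
    (hnz : ∀ i : Fin n, (i : ℕ) < r → lam i ≠ 0)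
    (hz : ∀ i : Fin n, r ≤ (i : ℕ) → lam i = 0)
    (hdist : ∀ i j : Fin n, (i : ℕ) < r → (j : ℕ) < r → i ≠ j → lam i ≠ lam j)
    (x₀ : Fin n → ℝ) (c : Fin n → ℝ) (hx₀ : x₀ = ∑ i, c i • q i)
    (hν : ∃ i : Fin n, (i : ℕ) < r ∧ c i ≠ 0)
    (Pprev Pk S : Matrix (Fin n) (Fin n) ℝ)
    (hPprev : IsOrthProjOnto Pprev (krylovSpan A x₀ k))
    (hPk : IsOrthProjOnto Pk (krylovSpan A x₀ (k + 1)))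
    (hS : S = 1 - Pprev)
    (hSx : S.mulVec ((A ^ k).mulVec x₀) ≠ 0)
    (lmax lmin : ℝ)
    (hlmax : IsGreatest (Set.range fun i : Fin n => |lam i|) lmax)
    (hlmin : IsLeast (Set.range fun i : Fin n => |lam i|) lmin) :
    Matrix.trace ((A - A * Pk)ᵀ * (A - A * Pk))
      ≤ ((n : ℝ) - (min k
            ((Finset.univ.filter fun i : Fin n => (i : ℕ) < r ∧ c i ≠ 0).card
              + min ((Finset.univ.filter fun i : Fin n => r ≤ (i : ℕ) ∧ c i ≠ 0).card) 1) : ℕ))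
          * lmax ^ 2 - lmin ^ 2 := by
  have hmem : (A ^ k).mulVec x₀ ∉ krylovSpan A x₀ k := by
    intro h
    rw [← hPprev.2.2] at h
    obtain ⟨y, hy⟩ := h
    apply hSx
    rw [← hy, hS, Matrix.mulVecLin_apply, Matrix.mulVec_mulVec, Matrix.sub_mul, Matrix.one_mul,
      hPprev.2.1, sub_self, Matrix.zero_mulVec]
  have htr : (k : ℝ) + 1 ≤ Pk.trace := by
    rw [hPk.trace_eq_finrank]
    exact_mod_cast succ_le_finrank_krylovSpan A x₀ k hmem
  set R : Matrix (Fin n) (Fin n) ℝ := 1 - Pk with hR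
  have hRsymm : Rᵀ = R := by rw [hR, Matrix.transpose_sub, Matrix.transpose_one, hPk.1.eq]
  have hRidem : R * R = R := by
    simp [hR, Matrix.sub_mul, Matrix.mul_sub, hPk.2.1]
  have hRtr : R.trace = n - Pk.trace := by simp [hR]
  have hRnonneg : ∀ v, 0 ≤ v ⬝ᵥ R.mulVec v := fun v => by
    have h : v ⬝ᵥ R.mulVec v = R.mulVec v ⬝ᵥ R.mulVec v := by
      rw [Matrix.dotProduct_mulVec (R.mulVec v), ← Matrix.mulVec_transpose, hRsymm,
        Matrix.mulVec_mulVec, hRidem, dotProduct_comm]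
    rw [h]
    exact Finset.sum_nonneg fun i _ => mul_self_nonneg _
  have hsq : ∀ i, lam i ^ 2 ≤ lmax ^ 2 := fun i =>
    sq_le_sq.2 ((hlmax.2 ⟨i, rfl⟩).trans (le_abs_self _))
  have htrace : Matrix.trace ((A - A * Pk)ᵀ * (A - A * Pk)) ≤ lmax ^ 2 * R.trace := by
    have hAR : A - A * Pk = A * R := by rw [hR, Matrix.mul_sub, Matrix.mul_one]
    rw [hAR, Matrix.transpose_mul, hRsymm, hA.eq, Matrix.mul_assoc, Matrix.trace_mul_comm,
      Matrix.mul_assoc, Matrix.mul_assoc, hRidem, Matrix.trace_mul_comm, Matrix.mul_assoc,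
      Matrix.trace_mul_comm, Matrix.mul_assoc, trace_eq_sum_dotProduct horth,
      trace_eq_sum_dotProduct horth R, Finset.mul_sum]
    refine Finset.sum_le_sum fun i _ => ?_
    have h : q i ⬝ᵥ (R * (A * A)).mulVec (q i) = lam i ^ 2 * (q i ⬝ᵥ R.mulVec (q i)) := by
      simp only [← Matrix.mulVec_mulVec, heig, Matrix.mulVec_smul, dotProduct_smul, smul_eq_mul]
      ring
    rw [h]
    exact mul_le_mul_of_nonneg_right (hsq i) (hRnonneg _)
  obtain ⟨i, hi⟩ := hlmin.1
  have hmin : lmin ^ 2 ≤ lmax ^ 2 := by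
    rw [← hi, sq_abs]
    exact hsq i
  set d := min k
    ((Finset.univ.filter fun i : Fin n => (i : ℕ) < r ∧ c i ≠ 0).card
      + min ((Finset.univ.filter fun i : Fin n => r ≤ (i : ℕ) ∧ c i ≠ 0).card) 1)
  have hd : (d : ℝ) ≤ k := by exact_mod_cast min_le_left _ _
  rw [hRtr] at htrace
  nlinarith [mul_le_mul_of_nonneg_left htr (sq_nonneg lmax),
    mul_le_mul_of_nonneg_left hd (sq_nonneg lmax)]
end

section
/- Let A ∈ ℝ^{n×n} be symmetric of rank r whose nonzero eigenvalues λ₁, …, λ_r are pairwise distinct, with orthonormal eigenvectors q₁, …, q_r, and let q̄_{r+1}, …, q̄_n be an orthonormal basis of ker A. Write x₀ = Σ_{i=1}^r ν_i q_i + Σ_{i=r+1}^n μ_i q̄_i. Then for every m ≥ 1, the n×m matrix with columns x₀, A x₀, …, A^{m−1} x₀ has rank equal to min{ m, |ν| + min{|μ|, 1} }, where |ν| and |μ| denote the numbers of nonzero entries of ν and μ respectively. -/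
open Matrix

/-- The scaled Vandermonde matrix `(c i * v i ^ j)` has rank `min m k`, where `k` is the number of
distinct nodes `v i` with nonzero weight `c i`. -/
theorem rank_weighted_vandermonde {ι K : Type*} [Fintype ι] [Field K] [DecidableEq K]
    (c v : ι → K) (m : ℕ) :
    (Matrix.of fun (i : ι) (j : Fin m) => c i * v i ^ (j : ℕ)).rank
      = min m ((Finset.univ.filter fun i => c i ≠ 0).image v).card := by
  set S := (Finset.univ.filter fun i => c i ≠ 0).image v with hS
  let f : K → Fin m → K := fun s j => s ^ (j : ℕ)
  have hspan : Submodule.span K (Set.range (Matrix.of fun (i : ι) (j : Fin m) =>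
      c i * v i ^ (j : ℕ)).row) = Submodule.span K (S.image f : Set (Fin m → K)) := by
    have hrow : ∀ i, (Matrix.of fun (i : ι) (j : Fin m) => c i * v i ^ (j : ℕ)).row i
        = c i • f (v i) := fun i => rfl
    apply le_antisymm <;> rw [Submodule.span_le]
    · rintro _ ⟨i, rfl⟩
      rw [hrow]
      by_cases hc : c i = 0
      · simp [hc]
      · refine Submodule.smul_mem _ _ (Submodule.subset_span ?_)
        exact Finset.mem_image_of_mem f (Finset.mem_image_of_mem v (by simpa using hc))
    · intro x hx
      simp only [Finset.coe_image, Set.mem_image, hS, Finset.coe_filter, Finset.mem_univ,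
        true_and, Set.mem_ofPred_eq] at hx
      obtain ⟨_, ⟨i, hi, rfl⟩, rfl⟩ := hx
      rw [← inv_smul_smul₀ hi (f (v i)), ← hrow]
      exact Submodule.smul_mem _ _ (Submodule.subset_span ⟨i, rfl⟩)
  apply le_antisymm
  · refine le_min ((Matrix.rank_le_card_width _).trans_eq (Fintype.card_fin m)) ?_
    rw [Matrix.rank_eq_finrank_span_row, hspan]
    exact (finrank_span_finset_le_card _).trans Finset.card_image_le
  · rw [Matrix.rank_eq_finrank_span_row, hspan]
    set k := min m S.card
    obtain ⟨e⟩ : Nonempty (Fin k ↪ S) :=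
      Function.Embedding.nonempty_of_card_le (by simp [k])
    have hli : LinearIndependent K (fun a : Fin k => f (e a)) := by
      apply LinearIndependent.of_comp (LinearMap.funLeft K K (Fin.castLE (min_le_left m S.card)))
      exact Matrix.linearIndependent_rows_of_det_ne_zero (Matrix.det_vandermonde_ne_zero_iff.2
        (Subtype.val_injective.comp e.injective))
    calc k = Module.finrank K (Submodule.span K (Set.range fun a : Fin k => f (e a))) := by
          rw [finrank_span_eq_card hli, Fintype.card_fin]
      _ ≤ _ := by
          apply Submodule.finrank_mono (Submodule.span_mono _)
          rintro _ ⟨a, rfl⟩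
          exact Finset.mem_image_of_mem f (e a).2

theorem Matrix.pow_mulVec_eq_smul {ι R : Type*} [Fintype ι] [DecidableEq ι] [CommSemiring R]
    {A : Matrix ι ι R} {x : ι → R} {l : R} (h : A *ᵥ x = l • x) (k : ℕ) :
    (A ^ k) *ᵥ x = l ^ k • x := by
  induction k with
  | zero => simp
  | succ k ih => rw [pow_succ, ← mulVec_mulVec, h, mulVec_smul, ih, smul_smul, pow_succ']

/-- If `v` is injective and nonzero on `p` and vanishes off `p`, then the image under `v` of
the indices satisfying `d` has one element for each index in `p`, plus one if some index is
outside `p`. -/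
theorem card_image_filter_eq_add_min {ι K : Type*} [Fintype ι] [Zero K] [DecidableEq K]
    (v : ι → K) (p d : ι → Prop) [DecidablePred p] [DecidablePred d]
    (hnz : ∀ i, p i → v i ≠ 0) (hz : ∀ i, ¬ p i → v i = 0)
    (hinj : ∀ i j, p i → p j → i ≠ j → v i ≠ v j) :
    ((Finset.univ.filter d).image v).card
      = (Finset.univ.filter fun i => p i ∧ d i).card
        + min (Finset.univ.filter fun i => ¬ p i ∧ d i).card 1 := by
  classical
  set P := Finset.univ.filter fun i => p i ∧ d i with hP
  set N := Finset.univ.filter fun i => ¬ p i ∧ d i with hN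
  have hunion : Finset.univ.filter d = P ∪ N := by
    ext i
    simp only [hP, hN, Finset.mem_union, Finset.mem_filter, Finset.mem_univ, true_and]
    tauto
  have hdisj : Disjoint (P.image v) (N.image v) := by
    rw [Finset.disjoint_left]
    simp only [hP, hN, Finset.mem_image, Finset.mem_filter, Finset.mem_univ, true_and]
    rintro _ ⟨i, ⟨hi, -⟩, rfl⟩ ⟨j, ⟨hj, -⟩, hij⟩
    exact hnz i hi (hij ▸ hz j hj)
  rw [hunion, Finset.image_union, Finset.card_union_of_disjoint hdisj]
  congr 1
  · apply Finset.card_image_of_injOn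
    intro i hi j hj hij
    by_contra hne
    exact hinj i j (Finset.mem_filter.1 hi).2.1 (Finset.mem_filter.1 hj).2.1 hne hij
  · rcases N.eq_empty_or_nonempty with h | h
    · simp [h]
    · have himage : N.image v = {0} := by
        rw [Finset.image_congr (g := fun _ => 0) fun i hi => hz i (Finset.mem_filter.1 hi).2.1,
          Finset.image_const h]
      rw [himage, min_eq_right h.card_pos, Finset.card_singleton]

/-- `A` is symmetric with an orthonormal eigenbasis `q`, eigenvalues
`lam i` nonzero and pairwise distinct for `i < r` and zero for `i ≥ r` (so `A` has rank `r`
and `q i`, `i ≥ r`, is an orthonormal basis of `ker A`), and `x₀ = ∑ i, c i • q i`.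
Then for every `m ≥ 1`, the `n × m` data matrix with columns `x₀, A x₀, …, A^{m−1} x₀`
has rank `min{m, |ν| + min{|μ|, 1}}`, where `|ν|` (resp. `|μ|`) is the number of nonzero
coefficients `c i` with `i < r` (resp. `i ≥ r`). -/
theorem stmt_6 {n r : ℕ} (A : Matrix (Fin n) (Fin n) ℝ) (hA : A.IsSymm)
    (q : Fin n → Fin n → ℝ) (lam : Fin n → ℝ)
    (horth : ∀ i j, q i ⬝ᵥ q j = if i = j then 1 else 0)
    (heig : ∀ i, A.mulVec (q i) = lam i • q i)
    (hnz : ∀ i : Fin n, (i : ℕ) < r → lam i ≠ 0)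
    (hz : ∀ i : Fin n, r ≤ (i : ℕ) → lam i = 0)
    (hdist : ∀ i j : Fin n, (i : ℕ) < r → (j : ℕ) < r → i ≠ j → lam i ≠ lam j)
    (x₀ : Fin n → ℝ) (c : Fin n → ℝ) (hx₀ : x₀ = ∑ i, c i • q i)
    (m : ℕ) (hm : 1 ≤ m) :
    (Matrix.of fun (i : Fin n) (j : Fin m) => ((A ^ (j : ℕ)).mulVec x₀) i).rank
      = min m ((Finset.univ.filter fun i : Fin n => (i : ℕ) < r ∧ c i ≠ 0).card
          + min ((Finset.univ.filter fun i : Fin n => r ≤ (i : ℕ) ∧ c i ≠ 0).card) 1) := by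
  have hfactor : (Matrix.of fun (i : Fin n) (j : Fin m) => ((A ^ (j : ℕ)).mulVec x₀) i)
      = (Matrix.of q)ᵀ * Matrix.of fun (i : Fin n) (j : Fin m) => c i * lam i ^ (j : ℕ) := by
    ext i j
    simp only [hx₀, mulVec_sum, mulVec_smul, pow_mulVec_eq_smul (heig _), of_apply, mul_apply,
      transpose_apply, Finset.sum_apply, Pi.smul_apply, smul_eq_mul]
    exact Finset.sum_congr rfl fun k _ => by ring
  have hunit : IsUnit ((Matrix.of q)ᵀ).det := by
    apply Matrix.isUnit_det_of_left_inverse (B := Matrix.of q)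
    ext i j
    rw [one_apply, ← horth i j]
    rfl
  rw [hfactor, Matrix.rank_mul_eq_right_of_isUnit_det _ _ hunit, rank_weighted_vandermonde,
    card_image_filter_eq_add_min lam (fun i => (i : ℕ) < r) (fun i => c i ≠ 0) hnz
      (fun i hi => hz i (not_lt.1 hi)) hdist]
  simp only [not_lt]
end

section
/- (Lemma 4) Let A ∈ ℝ^{n×n} be symmetric with exactly s distinct eigenvalues, and let k satisfy k + 1 ≥ s. Let λ be a simple eigenvalue of A (its eigenspace ker(A − λ I) is one-dimensional) with unit eigenvector q, and suppose ⟨x₀, q⟩ ≠ 0. If u ∈ ℝⁿ satisfies ⟨u, A^j x₀⟩ = 0 for all 0 ≤ j ≤ k, then ⟨u, q⟩ = 0. -/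
open Matrix

/-- `μ` is an eigenvalue of the real matrix `A`. -/
def IsEigenvalue {n : ℕ} (A : Matrix (Fin n) (Fin n) ℝ) (μ : ℝ) : Prop :=
  ∃ v : Fin n → ℝ, v ≠ 0 ∧ A.mulVec v = μ • v

/-- The multiplicity of `μ` as an eigenvalue of `A`: `dim ker (A − μ I)`. -/
noncomputable def eigMult {n : ℕ} (A : Matrix (Fin n) (Fin n) ℝ) (μ : ℝ) : ℕ :=
  Module.finrank ℝ (LinearMap.ker (Matrix.mulVecLin (A - μ • 1)))

open Polynomial in
theorem Matrix.aeval_mulVec_of_mulVec_eq_smul {n : ℕ} {A : Matrix (Fin n) (Fin n) ℝ} {μ : ℝ}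
    {v : Fin n → ℝ} (hv : A.mulVec v = μ • v) (p : ℝ[X]) :
    (aeval A p).mulVec v = p.eval μ • v := by
  induction p using Polynomial.induction_on' with
  | add p q hp hq => simp [Matrix.add_mulVec, hp, hq, add_smul]
  | monomial m a =>
    have hpow : (A ^ m).mulVec v = μ ^ m • v := by
      induction m with
      | zero => simp
      | succ m ih =>
        rw [pow_succ, ← Matrix.mulVec_mulVec, hv, Matrix.mulVec_smul, ih, smul_smul, pow_succ']
    rw [aeval_monomial, ← Algebra.smul_def, Matrix.smul_mulVec, hpow, eval_monomial, smul_smul]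

open Polynomial in
/-- A polynomial vanishing at every eigenvalue of a real symmetric matrix annihilates it. -/
theorem Matrix.IsSymm.aeval_eq_zero {n : ℕ} {A : Matrix (Fin n) (Fin n) ℝ} (hA : A.IsSymm)
    {p : ℝ[X]} (hp : ∀ μ, IsEigenvalue A μ → p.eval μ = 0) : aeval A p = 0 := by
  have hH : A.IsHermitian := by
    rwa [Matrix.IsHermitian, Matrix.conjTranspose_eq_transpose_of_trivial]
  let b := hH.eigenvectorBasis.toBasis.map (WithLp.linearEquiv 2 ℝ (Fin n → ℝ))
  have hb (j : Fin n) : A.mulVec (b j) = hH.eigenvalues j • b j := by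
    simpa [b] using hH.mulVec_eigenvectorBasis j
  have hlin : Matrix.mulVecLin (aeval A p) = 0 := by
    refine b.ext fun j => ?_
    rw [Matrix.mulVecLin_apply, Matrix.aeval_mulVec_of_mulVec_eq_smul (hb j),
      hp _ ⟨b j, b.ne_zero j, hb j⟩, zero_smul, LinearMap.zero_apply]
  exact Matrix.mulVec_injective (by
    funext v
    simpa using LinearMap.congr_fun hlin v)

open Polynomial in
theorem Matrix.dotProduct_aeval_mulVec_eq_zero {n k : ℕ} {A : Matrix (Fin n) (Fin n) ℝ}
    {u x : Fin n → ℝ} (hu : ∀ j ≤ k, u ⬝ᵥ (A ^ j).mulVec x = 0) {p : ℝ[X]}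
    (hp : p.natDegree ≤ k) : u ⬝ᵥ (aeval A p).mulVec x = 0 := by
  rw [aeval_eq_sum_range, Matrix.sum_mulVec, dotProduct_sum]
  refine Finset.sum_eq_zero fun j hj => ?_
  rw [Matrix.smul_mulVec, dotProduct_smul, hu j (by grind), smul_zero]

/-- Lemma 4: `A` symmetric with exactly `s` distinct eigenvalues and
`k + 1 ≥ s`; `lam` a simple eigenvalue (`dim ker (A − λ I) = 1`) with unit eigenvector `q`
not orthogonal to `x₀`.  If `u` is orthogonal to `A^j x₀` for all `0 ≤ j ≤ k`,
then `u ⊥ q`. -/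
theorem stmt_9 {n s k : ℕ} (A : Matrix (Fin n) (Fin n) ℝ) (hA : A.IsSymm)
    (ev : Finset ℝ) (hev : ∀ μ : ℝ, μ ∈ ev ↔ IsEigenvalue A μ) (hcard : ev.card = s)
    (hk : s ≤ k + 1)
    (lam : ℝ) (q : Fin n → ℝ) (hq : A.mulVec q = lam • q) (hq1 : q ⬝ᵥ q = 1)
    (hsimple : eigMult A lam = 1)
    (x₀ : Fin n → ℝ) (hx₀ : x₀ ⬝ᵥ q ≠ 0)
    (u : Fin n → ℝ) (hu : ∀ j ≤ k, u ⬝ᵥ (A ^ j).mulVec x₀ = 0) :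
    u ⬝ᵥ q = 0 := by
  have hq0 : q ≠ 0 := by
    rintro rfl
    simp at hq1
  have hlam : lam ∈ ev := (hev lam).2 ⟨q, hq0, hq⟩
  let p : Polynomial ℝ := ∏ μ ∈ ev.erase lam, (Polynomial.X - Polynomial.C μ)
  have hpdeg : p.natDegree ≤ k := by
    rw [Polynomial.natDegree_finsetProd_X_sub_C_eq_card, Finset.card_erase_of_mem hlam]
    omega
  have hplam : p.eval lam ≠ 0 := by
    rw [Polynomial.eval_prod, Finset.prod_ne_zero_iff]
    intro μ hμ
    simpa [sub_eq_zero] using (Finset.ne_of_mem_erase hμ).symm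
  set w := (Polynomial.aeval A p).mulVec x₀ with hw
  have hann : Polynomial.aeval A ((Polynomial.X - Polynomial.C lam) * p) = 0 := by
    refine hA.aeval_eq_zero fun μ hμ => ?_
    rw [Finset.mul_prod_erase ev (fun μ => Polynomial.X - Polynomial.C μ) hlam,
      Polynomial.eval_prod]
    exact Finset.prod_eq_zero ((hev μ).2 hμ) (by simp)
  have hwker : w ∈ LinearMap.ker (Matrix.mulVecLin (A - lam • 1)) := by
    have h : (A - lam • 1) * Polynomial.aeval A p = 0 := by
      simpa [Algebra.algebraMap_eq_smul_one] using hann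
    rw [LinearMap.mem_ker, Matrix.mulVecLin_apply, hw, Matrix.mulVec_mulVec, h,
      Matrix.zero_mulVec]
  have hqker : q ∈ LinearMap.ker (Matrix.mulVecLin (A - lam • 1)) := by
    simp [hq]
  obtain ⟨c, hc⟩ := (finrank_eq_one_iff_of_nonzero' (⟨q, hqker⟩ :
    LinearMap.ker (Matrix.mulVecLin (A - lam • 1))) (by simpa using hq0)).1 hsimple ⟨w, hwker⟩
  replace hc : c • q = w := congrArg Subtype.val hc
  have hsymm : (Polynomial.aeval A p)ᵀ = Polynomial.aeval A p := by
    simp [Polynomial.aeval_eq_sum_range, Matrix.transpose_sum, Matrix.transpose_pow, hA.eq]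
  have hwq : w ⬝ᵥ q = p.eval lam * (x₀ ⬝ᵥ q) := by
    rw [hw, ← hsymm, Matrix.mulVec_transpose, ← Matrix.dotProduct_mulVec,
      Matrix.aeval_mulVec_of_mulVec_eq_smul hq, dotProduct_smul, smul_eq_mul]
  have hcne : c ≠ 0 := by
    rintro rfl
    rw [← hc, zero_smul, zero_dotProduct] at hwq
    exact mul_ne_zero hplam hx₀ hwq.symm
  have huw : u ⬝ᵥ w = 0 := Matrix.dotProduct_aeval_mulVec_eq_zero hu hpdeg
  rw [← hc, dotProduct_smul, smul_eq_mul] at huw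
  exact (mul_eq_zero.1 huw).resolve_left hcne
end

section
/- (Theorem 4) Let A ∈ ℝ^{n×n} be symmetric with exactly s distinct eigenvalues, and suppose A has at least one eigenvalue of multiplicity greater than one. Let x₀ ∈ ℝⁿ be generic for A (its orthogonal projection onto every eigenspace of A is nonzero), and let k ≥ s. Then the model estimate Â_k = A Π_k satisfies ‖A − Â_k‖₂ = λ* := max{ |λ| : λ an eigenvalue of A with dim ker(A − λ I) > 1 }, where ‖·‖₂ is the spectral norm. -/
open Matrix

/-- The spectral norm of a real matrix: the operator norm of the induced linear map
on Euclidean space. -/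
noncomputable def specNorm {n : ℕ} (M : Matrix (Fin n) (Fin n) ℝ) : ℝ :=
  ‖LinearMap.toContinuousLinearMap (Matrix.toEuclideanLin M)‖

open Polynomial

/-- An eigenvector of a symmetric matrix pairs with `q(A) y` through the scalar `q(μ)`. -/
lemma dotProduct_aeval_mulVec {n : ℕ} {A : Matrix (Fin n) (Fin n) ℝ} (hA : A.IsSymm)
    {u : Fin n → ℝ} {μ : ℝ} (hu : A *ᵥ u = μ • u) (q : ℝ[X]) (y : Fin n → ℝ) :
    u ⬝ᵥ ((aeval A q) *ᵥ y) = q.eval μ * (u ⬝ᵥ y) := by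
  have hpow : ∀ (j : ℕ) (y : Fin n → ℝ), u ⬝ᵥ ((A ^ j) *ᵥ y) = μ ^ j * (u ⬝ᵥ y) := by
    intro j
    induction j with
    | zero => simp
    | succ j ih =>
      intro y
      have h : u ⬝ᵥ (A *ᵥ y) = μ * (u ⬝ᵥ y) := by
        rw [dotProduct_mulVec, ← mulVec_transpose, hA.eq, hu, smul_dotProduct, smul_eq_mul]
      rw [pow_succ, ← mulVec_mulVec, ih, h]
      ring
  rw [aeval_eq_sum_range, eval_eq_sum_range, sum_mulVec, dotProduct_sum, Finset.sum_mul]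
  refine Finset.sum_congr rfl fun j _ => ?_
  rw [smul_mulVec, dotProduct_smul, hpow, smul_eq_mul, mul_assoc]

/-- Polynomials of degree below `m` in `A` map `x₀` into the Krylov space of order `m`. -/
lemma aeval_mulVec_mem_krylovSpan {n m : ℕ} (A : Matrix (Fin n) (Fin n) ℝ) (x₀ : Fin n → ℝ)
    {q : ℝ[X]} (hq : q.natDegree < m) : (aeval A q) *ᵥ x₀ ∈ krylovSpan A x₀ m := by
  rw [aeval_eq_sum_range, sum_mulVec]
  refine Submodule.sum_mem _ fun j hj => ?_
  rw [smul_mulVec]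
  refine Submodule.smul_mem _ _ (Submodule.subset_span ⟨⟨j, ?_⟩, rfl⟩)
  have := Finset.mem_range.1 hj
  omega

/-- Eigenvectors orthogonal to `x₀` are orthogonal to every Krylov space of `x₀`. -/
lemma dotProduct_eq_zero_of_mem_krylovSpan {n m : ℕ} {A : Matrix (Fin n) (Fin n) ℝ}
    (hA : A.IsSymm) {x₀ v : Fin n → ℝ} {μ : ℝ} (hv : A *ᵥ v = μ • v) (hx : v ⬝ᵥ x₀ = 0)
    {w : Fin n → ℝ} (hw : w ∈ krylovSpan A x₀ m) : v ⬝ᵥ w = 0 := by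
  induction hw using Submodule.span_induction with
  | mem w hw =>
    obtain ⟨j, rfl⟩ := hw
    simpa [hx] using dotProduct_aeval_mulVec hA hv (X ^ (j : ℕ)) x₀
  | zero => simp
  | add a b _ _ ha hb => rw [dotProduct_add, ha, hb, add_zero]
  | smul c a _ ha => rw [dotProduct_smul, ha, smul_zero]

lemma IsOrthProjOnto.mulVec_eq_zero {n : ℕ} {P : Matrix (Fin n) (Fin n) ℝ}
    {W : Submodule ℝ (Fin n → ℝ)} (hP : IsOrthProjOnto P W) {v : Fin n → ℝ}
    (hv : ∀ w ∈ W, v ⬝ᵥ w = 0) : P *ᵥ v = 0 := by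
  obtain ⟨hs, hi, hr⟩ := hP
  refine dotProduct_self_eq_zero.1 ?_
  rw [dotProduct_comm, dotProduct_mulVec, ← mulVec_transpose, hs.eq, mulVec_mulVec, hi,
    dotProduct_comm]
  exact hv _ (hr ▸ ⟨v, rfl⟩)

lemma IsOrthProjOnto.dotProduct_sub_mulVec {n : ℕ} {P : Matrix (Fin n) (Fin n) ℝ}
    {W : Submodule ℝ (Fin n → ℝ)} (hP : IsOrthProjOnto P W) (y : Fin n → ℝ) {w : Fin n → ℝ}
    (hw : w ∈ W) : w ⬝ᵥ (y - P *ᵥ y) = 0 := by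
  obtain ⟨hs, hi, hr⟩ := hP
  rw [← hr] at hw
  obtain ⟨t, rfl⟩ := hw
  rw [mulVecLin_apply, dotProduct_sub, dotProduct_mulVec (P *ᵥ t), ← mulVec_transpose, hs.eq,
    mulVec_mulVec, hi, sub_self]

lemma mem_ker_mulVecLin_sub_smul_one {n : ℕ} {A : Matrix (Fin n) (Fin n) ℝ} {μ : ℝ}
    {v : Fin n → ℝ} : v ∈ LinearMap.ker (mulVecLin (A - μ • 1)) ↔ A *ᵥ v = μ • v := by
  rw [LinearMap.mem_ker, mulVecLin_apply, sub_mulVec, smul_mulVec, one_mulVec, sub_eq_zero]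

/-- An eigenspace of dimension at least two contains a nonzero vector orthogonal to `x`. -/
lemma exists_eigenvector_dotProduct_eq_zero {n : ℕ} {A : Matrix (Fin n) (Fin n) ℝ} {μ : ℝ}
    (h : 1 < eigMult A μ) (x : Fin n → ℝ) :
    ∃ v : Fin n → ℝ, v ≠ 0 ∧ A *ᵥ v = μ • v ∧ v ⬝ᵥ x = 0 := by
  let f : LinearMap.ker (mulVecLin (A - μ • 1)) →ₗ[ℝ] ℝ :=
    (dotProductBilin ℝ ℝ x).comp (Submodule.subtype _)
  have hf : LinearMap.ker f ≠ ⊥ :=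
    LinearMap.ker_ne_bot_of_finrank_lt (by rwa [Module.finrank_self])
  obtain ⟨v, hv, hv0⟩ := Submodule.exists_mem_ne_zero_of_ne_bot hf
  refine ⟨v, by simpa using hv0, mem_ker_mulVecLin_sub_smul_one.1 v.2, ?_⟩
  rw [dotProduct_comm]
  exact hv

/-- An orthonormal eigenbasis of a real symmetric matrix. -/
lemma exists_orthonormalBasis_eigenvectors {n : ℕ} {A : Matrix (Fin n) (Fin n) ℝ}
    (hA : A.IsSymm) : ∃ (b : OrthonormalBasis (Fin n) ℝ (EuclideanSpace ℝ (Fin n)))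
      (l : Fin n → ℝ), ∀ i, A *ᵥ (b i).ofLp = l i • (b i).ofLp := by
  have hH : A.IsHermitian := by rwa [IsHermitian, conjTranspose_eq_transpose_of_trivial]
  exact ⟨hH.eigenvectorBasis, hH.eigenvalues, fun i => hH.mulVec_eigenvectorBasis i⟩

lemma inner_eq_dotProduct {n : ℕ} (x y : EuclideanSpace ℝ (Fin n)) :
    inner ℝ x y = x.ofLp ⬝ᵥ y.ofLp := by
  rw [EuclideanSpace.inner_eq_star_dotProduct, star_trivial, dotProduct_comm]

/-- A polynomial vanishing on all eigenvalues of a symmetric matrix annihilates it. -/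
lemma aeval_mulVec_eq_zero {n : ℕ} {A : Matrix (Fin n) (Fin n) ℝ} (hA : A.IsSymm)
    {q : ℝ[X]} (hq : ∀ μ, IsEigenvalue A μ → q.eval μ = 0) (x : Fin n → ℝ) :
    (aeval A q) *ᵥ x = 0 := by
  obtain ⟨b, l, hb⟩ := exists_orthonormalBasis_eigenvectors hA
  have h : WithLp.toLp 2 ((aeval A q) *ᵥ x) = 0 := by
    refine b.repr.injective (PiLp.ext fun i => ?_)
    have hne : (b i).ofLp ≠ 0 := fun h0 => b.toBasis.ne_zero i (by simpa using h0)
    rw [b.repr_apply_apply, b.repr_apply_apply, inner_zero_right, inner_eq_dotProduct,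
      dotProduct_aeval_mulVec hA (hb i), hq _ ⟨_, hne, hb i⟩, zero_mul]
  simpa using h

/-- A vector orthogonal to a large enough Krylov space of a generic vector is orthogonal to the
eigenspaces of all simple eigenvalues. -/
lemma dotProduct_eq_zero_of_eigMult_le_one {n m : ℕ} {A : Matrix (Fin n) (Fin n) ℝ}
    (hA : A.IsSymm) {ev : Finset ℝ} (hev : ∀ μ : ℝ, μ ∈ ev ↔ IsEigenvalue A μ)
    {x₀ : Fin n → ℝ} {μ : ℝ} (hμ : μ ∈ ev)
    (hgen : ∃ v : Fin n → ℝ, A *ᵥ v = μ • v ∧ v ⬝ᵥ x₀ ≠ 0) (hm : ev.card ≤ m)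
    (hmult : eigMult A μ ≤ 1) {z : Fin n → ℝ} (hz : ∀ w ∈ krylovSpan A x₀ m, w ⬝ᵥ z = 0)
    {u : Fin n → ℝ} (hu : A *ᵥ u = μ • u) : u ⬝ᵥ z = 0 := by
  obtain ⟨g, hg, hgx⟩ := hgen
  obtain ⟨⟨v, hv⟩, hspan⟩ := finrank_le_one_iff.1 hmult
  have hspan' : ∀ w : Fin n → ℝ, A *ᵥ w = μ • w → ∃ c : ℝ, c • v = w := fun w hw =>
    (hspan ⟨w, mem_ker_mulVecLin_sub_smul_one.2 hw⟩).imp fun c hc => congrArg Subtype.val hc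
  rw [mem_ker_mulVecLin_sub_smul_one] at hv
  let p : ℝ[X] := ∏ ν ∈ ev.erase μ, (X - C ν)
  have hdeg : p.natDegree < m := by
    have h1 : p.natDegree = (ev.erase μ).card := natDegree_finsetProd_X_sub_C_eq_card _ _
    have h2 := Finset.card_erase_lt_of_mem hμ
    omega
  have hpμ : p.eval μ ≠ 0 := by
    rw [eval_prod, Finset.prod_ne_zero_iff]
    intro ν hν
    simpa [sub_eq_zero] using (Finset.ne_of_mem_erase hν).symm
  have hw : A *ᵥ ((aeval A p) *ᵥ x₀) = μ • ((aeval A p) *ᵥ x₀) := by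
    have h := aeval_mulVec_eq_zero (q := (X - C μ) * p) hA (fun ν hν => by
      rw [Finset.mul_prod_erase ev (fun ν => X - C ν) hμ, eval_prod]
      exact Finset.prod_eq_zero ((hev ν).2 hν) (by simp)) x₀
    rw [map_mul, ← mulVec_mulVec, map_sub, aeval_X, aeval_C, Algebra.algebraMap_eq_smul_one,
      ← mulVecLin_apply] at h
    exact mem_ker_mulVecLin_sub_smul_one.1 h
  obtain ⟨c, hc⟩ := hspan' _ hw
  obtain ⟨d, rfl⟩ := hspan' _ hg
  obtain ⟨e, rfl⟩ := hspan' _ hu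
  have hvx : v ⬝ᵥ x₀ ≠ 0 := fun h => hgx (by rw [smul_dotProduct, h, smul_zero])
  have hc0 : c ≠ 0 := by
    rintro rfl
    have h := dotProduct_aeval_mulVec hA hv p x₀
    rw [← hc, zero_smul, dotProduct_zero] at h
    exact mul_ne_zero hpμ hvx h.symm
  have hvz := hz _ (aeval_mulVec_mem_krylovSpan A x₀ hdeg)
  rw [← hc, smul_dotProduct, smul_eq_mul] at hvz
  rw [smul_dotProduct, (mul_eq_zero.1 hvz).resolve_left hc0, smul_zero]

/-- If `z` is orthogonal to all eigenvectors with eigenvalue exceeding `r` in absolute value,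
then `‖A z‖ ≤ r ‖z‖`. -/
lemma norm_mulVec_le_of_eigenvector_dotProduct_eq_zero {n : ℕ} {A : Matrix (Fin n) (Fin n) ℝ}
    (hA : A.IsSymm) {r : ℝ} (hr : 0 ≤ r) {z : Fin n → ℝ}
    (hz : ∀ (μ : ℝ) (u : Fin n → ℝ), u ≠ 0 → A *ᵥ u = μ • u → r < |μ| → u ⬝ᵥ z = 0) :
    ‖WithLp.toLp 2 (A *ᵥ z)‖ ≤ r * ‖WithLp.toLp 2 z‖ := by
  obtain ⟨b, l, hb⟩ := exists_orthonormalBasis_eigenvectors hA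
  refine abs_le_of_sq_le_sq' ?_ (by positivity) |>.2
  rw [mul_pow, ← b.sum_sq_norm_inner_right, ← b.sum_sq_norm_inner_right, Finset.mul_sum]
  refine Finset.sum_le_sum fun i _ => ?_
  have hne : (b i).ofLp ≠ 0 := fun h0 => b.toBasis.ne_zero i (by simpa using h0)
  have h := dotProduct_aeval_mulVec hA (hb i) X z
  rw [aeval_X, eval_X] at h
  rw [inner_eq_dotProduct, inner_eq_dotProduct, h, norm_mul, mul_pow]
  rcases le_or_gt |l i| r with hl | hl
  · exact mul_le_mul_of_nonneg_right (pow_le_pow_left₀ (abs_nonneg _) hl 2) (sq_nonneg _)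
  · simp [hz _ _ hne (hb i) hl]

lemma IsOrthProjOnto.norm_sub_mulVec_le {n : ℕ} {P : Matrix (Fin n) (Fin n) ℝ}
    {W : Submodule ℝ (Fin n → ℝ)} (hP : IsOrthProjOnto P W) (y : Fin n → ℝ) :
    ‖WithLp.toLp 2 (y - P *ᵥ y)‖ ≤ ‖WithLp.toLp 2 y‖ := by
  have h : inner ℝ (WithLp.toLp 2 (P *ᵥ y)) (WithLp.toLp 2 (y - P *ᵥ y)) = 0 := by
    rw [inner_eq_dotProduct]
    exact hP.dotProduct_sub_mulVec y (hP.2.2 ▸ ⟨y, rfl⟩)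
  have h2 := norm_add_sq_eq_norm_sq_add_norm_sq_real h
  rw [← WithLp.toLp_add, add_sub_cancel] at h2
  nlinarith [norm_nonneg (WithLp.toLp 2 y), mul_self_nonneg ‖WithLp.toLp 2 (P *ᵥ y)‖]

/-- Theorem 4: `A` symmetric with exactly `s` distinct eigenvalues, at
least one of multiplicity greater than one; `x₀` generic for `A` (every eigenspace
contains a vector not orthogonal to `x₀`); `k ≥ s`.  Then `‖A − Â_k‖₂ = λ*`, where
`λ* = max {|λ| : λ eigenvalue of A with m(λ) > 1}` and `Â_k = A Π_k`. -/
theorem stmt_10 {n s k : ℕ} (A : Matrix (Fin n) (Fin n) ℝ) (hA : A.IsSymm)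
    (ev : Finset ℝ) (hev : ∀ μ : ℝ, μ ∈ ev ↔ IsEigenvalue A μ) (hcard : ev.card = s)
    (hrep : ∃ μ, IsEigenvalue A μ ∧ 1 < eigMult A μ)
    (x₀ : Fin n → ℝ)
    (hgen : ∀ μ ∈ ev, ∃ v : Fin n → ℝ, A.mulVec v = μ • v ∧ v ⬝ᵥ x₀ ≠ 0)
    (hk : s ≤ k)
    (Pk : Matrix (Fin n) (Fin n) ℝ)
    (hPk : IsOrthProjOnto Pk (krylovSpan A x₀ (k + 1)))
    (lamstar : ℝ)
    (hstar : IsGreatest {x : ℝ | ∃ μ, IsEigenvalue A μ ∧ 1 < eigMult A μ ∧ x = |μ|} lamstar) :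
    specNorm (A - A * Pk) = lamstar := by
  have happ : ∀ y : EuclideanSpace ℝ (Fin n),
      LinearMap.toContinuousLinearMap (toEuclideanLin (A - A * Pk)) y =
        WithLp.toLp 2 (A *ᵥ (y.ofLp - Pk *ᵥ y.ofLp)) := fun y => by
    rw [LinearMap.coe_toContinuousLinearMap', toLpLin_apply, sub_mulVec, mulVec_sub,
      mulVec_mulVec]
  obtain ⟨⟨μ, -, hmult, rfl⟩, hmax⟩ := hstar
  refine le_antisymm (ContinuousLinearMap.opNorm_le_bound _ (abs_nonneg μ) fun y => ?_) ?_
  · rw [happ]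
    refine (norm_mulVec_le_of_eigenvector_dotProduct_eq_zero hA (abs_nonneg μ)
      fun ν u hu hν hlt => ?_).trans
      (mul_le_mul_of_nonneg_left (hPk.norm_sub_mulVec_le y.ofLp) (abs_nonneg μ))
    have hνev : ν ∈ ev := (hev ν).2 ⟨u, hu, hν⟩
    refine dotProduct_eq_zero_of_eigMult_le_one hA hev hνev (hgen ν hνev)
      (m := k + 1) (by omega) ?_ (fun w hw => hPk.dotProduct_sub_mulVec _ hw) hν
    by_contra! h
    exact hlt.not_ge (hmax ⟨ν, ⟨u, hu, hν⟩, h, rfl⟩)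
  · obtain ⟨v, hv0, hv, hvx⟩ := exists_eigenvector_dotProduct_eq_zero hmult x₀
    have hPv : Pk *ᵥ v = 0 := hPk.mulVec_eq_zero fun w hw =>
      dotProduct_eq_zero_of_mem_krylovSpan hA hv hvx hw
    have h := ContinuousLinearMap.le_opNorm
      (LinearMap.toContinuousLinearMap (toEuclideanLin (A - A * Pk))) (WithLp.toLp 2 v)
    rw [happ, hPv, sub_zero, hv, WithLp.toLp_smul, norm_smul, Real.norm_eq_abs] at h
    exact le_of_mul_le_mul_right h (norm_pos_iff.2 (by simpa using hv0))
end
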